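/- Let α > 0, let γ satisfy 0 < γ < min(1, α), let u_0 ∈ ℝ, and let f : {p^k : k ∈ ℤ} × ℝ → ℝ satisfy |f(p^ℓ, x)| ≤ M for all ℓ ∈ ℤ and x ∈ ℝ, |f(p^ℓ, x) − f(p^ℓ, y)| ≤ F_ℓ |x − y| with 0 < F_ℓ < p^{−αℓ} for every ℓ ∈ ℤ, and |f(p^ℓ, x)| ≤ A p^{−βℓ} for all ℓ ≥ 1 and x ∈ ℝ, where β + γ > α. Let u be a radial function on ℚ_p, bounded on some ball {t : |t|_p ≤ p^N}, with u(0) = u_0, satisfying the integral equation u(|t|_p) = u_0 + (I^α [ f̃(|·|_p, u(|·|_p)) ])(|t|_p) for every nonzero t ∈ ℚ_p. Then for every nonzero t ∈ ℚ_p the Vladimirov derivative (D^α u)(|t|_p) exists (the defining integral converges and depends only on |t|_p) and |t|_p^{γ} (D^α u)(|t|_p) = f(|t|_p, u(|t|_p)); that is, the mild solution solves the degenerate pseudo-differential equation. -/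

import Mathlib

open MeasureTheory Metric

noncomputable section

variable (p : ℕ) [Fact p.Prime]

instance : MeasurableSpace ℚ_[p] := borel _
instance : BorelSpace ℚ_[p] := ⟨rfl⟩

/-- The closed unit ball of `ℚ_[p]` as a positive compact set. -/
def unitBallPC : TopologicalSpace.PositiveCompacts ℚ_[p] where
  carrier := closedBall 0 1
  isCompact' := isCompact_closedBall 0 1
  interior_nonempty' := ⟨0, mem_interior_iff_mem_nhds.2
    (Filter.mem_of_superset (ball_mem_nhds 0 one_pos) ball_subset_closedBall)⟩

/-- The Haar measure on `ℚ_[p]` normalized so the unit ball has measure 1. -/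
def padicHaar : Measure ℚ_[p] := Measure.addHaarMeasure (unitBallPC p)

/-- A point on the sphere of radius `p^k`. -/
def sph (k : ℤ) : ℚ_[p] := (p : ℚ_[p]) ^ (-k)

/-- A function is radial if it depends only on the p-adic absolute value. -/
def Radial (u : ℚ_[p] → ℝ) : Prop := ∀ x y : ℚ_[p], ‖x‖ = ‖y‖ → u x = u y

/-- The integrand of the Vladimirov operator `D^α` at `x`. -/
def Dker (α : ℝ) (u : ℚ_[p] → ℝ) (x : ℚ_[p]) : ℚ_[p] → ℝ :=
  fun y => ‖y‖ ^ (-α - 1) * (u (x - y) - u x)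

/-- The Vladimirov fractional differentiation operator. -/
def Dop (α : ℝ) (u : ℚ_[p] → ℝ) (x : ℚ_[p]) : ℝ :=
  ((1 - (p : ℝ) ^ α) / (1 - (p : ℝ) ^ (-α - 1))) * ∫ y, Dker p α u x y ∂(padicHaar p)

/-- The kernel of the fractional integral `I^α`. -/
def Iker (α : ℝ) (x y : ℚ_[p]) : ℝ :=
  if α = 1 then Real.log ‖x - y‖ - Real.log ‖y‖
  else ‖x - y‖ ^ (α - 1) - ‖y‖ ^ (α - 1)

/-- The constant in front of the fractional integral. -/
def Icoef (α : ℝ) : ℝ :=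
  if α = 1 then (1 - (p : ℝ)) / (p * Real.log p)
  else (1 - (p : ℝ) ^ (-α)) / (1 - (p : ℝ) ^ (α - 1))

/-- The p-adic fractional integral `I^α`. -/
def Iop (α : ℝ) (u : ℚ_[p] → ℝ) (x : ℚ_[p]) : ℝ :=
  Icoef p α * ∫ y in {y : ℚ_[p] | ‖y‖ ≤ ‖x‖}, Iker p α x y * u y ∂(padicHaar p)

end

section MeasurePart

variable {p : ℕ} [hp : Fact p.Prime]

instance : (padicHaar p).IsAddHaarMeasure := by unfold padicHaar; infer_instance

lemma pR_pos : (0 : ℝ) < p := by exact_mod_cast hp.out.pos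
lemma pR_one_lt : (1 : ℝ) < p := by exact_mod_cast hp.out.one_lt

lemma ball_decomp (k : ℤ) : closedBall (0 : ℚ_[p]) ((p : ℝ) ^ (k + 1)) =
    ⋃ i ∈ Finset.range p, (fun x => (-((i : ℚ_[p]) * (p : ℚ_[p]) ^ (-(k + 1)))) + x) ⁻¹'
      closedBall (0 : ℚ_[p]) ((p : ℝ) ^ k) := by
  have hp0 : (p : ℚ_[p]) ≠ 0 := by exact_mod_cast hp.out.ne_zero
  have hpR := pR_pos (p := p)
  have hnn (m : ℤ) : ‖(p : ℚ_[p]) ^ m‖ = (p : ℝ) ^ (-m) := Padic.norm_p_zpow m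
  ext x
  simp only [Set.mem_iUnion, Set.mem_preimage, mem_closedBall, dist_zero_right, Finset.mem_range,
    exists_prop]
  constructor
  · intro hx
    have h1 : ‖x * (p : ℚ_[p]) ^ (k + 1)‖ ≤ 1 := by
      rw [norm_mul, hnn, zpow_neg]
      rw [mul_inv_le_iff₀ (by positivity)]
      simpa using hx
    let z : ℤ_[p] := ⟨x * (p : ℚ_[p]) ^ (k + 1), h1⟩
    refine ⟨z.zmodRepr, z.zmodRepr_lt_p, ?_⟩
    have h2 := z.norm_sub_zmodRepr_lt_one
    rw [PadicInt.norm_def] at h2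
    have h3 : ((z - (z.zmodRepr : ℤ_[p]) : ℤ_[p]) : ℚ_[p]) =
      x * (p : ℚ_[p]) ^ (k + 1) - (z.zmodRepr : ℚ_[p]) := by
      push_cast; rfl
    rw [h3] at h2
    rw [Padic.norm_le_pow_iff_norm_lt_pow_add_one]
    have h4 : -((z.zmodRepr : ℚ_[p]) * (p : ℚ_[p]) ^ (-(k + 1))) + x =
       (x * (p : ℚ_[p]) ^ (k + 1) - (z.zmodRepr : ℚ_[p])) * (p : ℚ_[p]) ^ (-(k + 1)) := by
      rw [sub_mul, mul_assoc, ← zpow_add₀ hp0]; simp; ring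
    rw [h4, norm_mul, hnn, neg_neg]
    have : (0 : ℝ) < (p : ℝ) ^ (k + 1) := by positivity
    nlinarith
  · rintro ⟨i, hi, h⟩
    have h4 : x = (i : ℚ_[p]) * (p : ℚ_[p]) ^ (-(k + 1)) +
      (-((i : ℚ_[p]) * (p : ℚ_[p]) ^ (-(k + 1))) + x) := by ring
    rw [h4]
    refine (Padic.nonarchimedean _ _).trans (max_le ?_ (h.trans ?_))
    · rw [norm_mul, hnn, neg_neg]
      have : (0 : ℝ) < (p : ℝ) ^ (k + 1) := by positivity
      have h5 : ‖(i : ℚ_[p])‖ ≤ 1 := by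
        exact_mod_cast Padic.norm_int_le_one (p := p) (i : ℤ)
      nlinarith
    · exact zpow_le_zpow_right₀ pR_one_lt.le (by omega)

lemma ball_succ (k : ℤ) : padicHaar p (closedBall (0 : ℚ_[p]) ((p : ℝ) ^ (k + 1))) =
    p * padicHaar p (closedBall (0 : ℚ_[p]) ((p : ℝ) ^ k)) := by
  have hnn (m : ℤ) : ‖(p : ℚ_[p]) ^ m‖ = (p : ℝ) ^ (-m) := Padic.norm_p_zpow m
  rw [ball_decomp, measure_biUnion_finset]
  · simp only [measure_preimage_add, Finset.sum_const, Finset.card_range, nsmul_eq_mul]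
  · intro i hi j hj hij
    rw [Function.onFun, Set.disjoint_left]
    intro x hx hy
    simp only [Set.mem_preimage, mem_closedBall, dist_zero_right] at hx hy
    have h1 : ‖((j : ℚ_[p]) - i) * (p : ℚ_[p]) ^ (-(k + 1))‖ ≤ (p : ℝ) ^ k := by
      have : ((j : ℚ_[p]) - i) * (p : ℚ_[p]) ^ (-(k + 1)) =
        (-((i : ℚ_[p]) * (p : ℚ_[p]) ^ (-(k + 1))) + x) +
          -(-((j : ℚ_[p]) * (p : ℚ_[p]) ^ (-(k + 1))) + x) := by ring
      rw [this]
      refine (Padic.nonarchimedean _ _).trans (max_le hx (by rwa [norm_neg]))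
    rw [Padic.norm_le_pow_iff_norm_lt_pow_add_one, norm_mul, hnn, neg_neg] at h1
    have hpk : (0 : ℝ) < (p : ℝ) ^ (k + 1) := by have := pR_pos (p := p); positivity
    have h2 : ‖((j : ℚ_[p]) - i)‖ < 1 := by
      by_contra h; push Not at h; nlinarith
    have h3 : ‖(((j : ℤ) - (i : ℤ) : ℤ) : ℚ_[p])‖ < 1 := by push_cast; exact h2
    rw [Padic.norm_intCast_lt_one_iff] at h3
    have hi' : i < p := by simpa using hi
    have hj' : j < p := by simpa using hj
    have := Int.eq_zero_of_abs_lt_dvd h3 (by rw [abs_lt]; constructor <;> omega)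
    omega
  · intro i _
    exact (measurable_const_add _) measurableSet_closedBall

lemma ball_measure (k : ℤ) : padicHaar p (closedBall (0 : ℚ_[p]) ((p : ℝ) ^ k)) =
    ENNReal.ofReal ((p : ℝ) ^ k) := by
  have h0 : padicHaar p (closedBall (0 : ℚ_[p]) ((p : ℝ) ^ (0 : ℤ))) = 1 := by
    have := Measure.addHaarMeasure_self (K₀ := unitBallPC p)
    rw [zpow_zero]; exact this
  have hpR := pR_pos (p := p)
  induction k using Int.induction_on with
  | zero => rw [h0]; simp
  | succ k ih =>
    rw [ball_succ, ih, zpow_add_one₀ hpR.ne', mul_comm ((p : ℝ) ^ _), ENNReal.ofReal_mul hpR.le]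
    simp
  | pred k ih =>
    have h := ball_succ (p := p) (-(k : ℤ) - 1)
    rw [sub_add_cancel, ih] at h
    have h2 : ENNReal.ofReal ((p : ℝ) ^ (-(k : ℤ))) =
      p * ENNReal.ofReal ((p : ℝ) ^ (-(k : ℤ) - 1)) := by
      rw [← ENNReal.ofReal_natCast, ← ENNReal.ofReal_mul hpR.le, mul_comm,
        ← zpow_add_one₀ hpR.ne', sub_add_cancel]
    rw [h2] at h
    exact ((ENNReal.mul_right_inj (by simpa using hp.out.ne_zero) (by simp)).1 h).symm

lemma sphere_eq (k : ℤ) : sphere (0 : ℚ_[p]) ((p : ℝ) ^ k) =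
    closedBall (0 : ℚ_[p]) ((p : ℝ) ^ k) \ closedBall (0 : ℚ_[p]) ((p : ℝ) ^ (k - 1)) := by
  ext x
  have := Padic.norm_le_pow_iff_norm_lt_pow_add_one x (k - 1)
  simp only [mem_sphere, dist_zero_right, Set.mem_sdiff, mem_closedBall, this, sub_add_cancel]
  constructor
  · intro h; simp [h]
  · rintro ⟨h1, h2⟩; linarith

lemma sphere_measure (k : ℤ) : (padicHaar p).real (sphere (0 : ℚ_[p]) ((p : ℝ) ^ k)) =
    (1 - (p : ℝ)⁻¹) * (p : ℝ) ^ k := by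
  have hpR := pR_pos (p := p)
  rw [sphere_eq, measureReal_sdiff (closedBall_subset_closedBall
    (zpow_le_zpow_right₀ pR_one_lt.le (by omega))) measurableSet_closedBall
     (by rw [ball_measure]; exact ENNReal.ofReal_ne_top)]
  simp only [measureReal_def, ball_measure]
  rw [ENNReal.toReal_ofReal (by positivity), ENNReal.toReal_ofReal (by positivity),
    zpow_sub_one₀ hpR.ne']
  ring

lemma haar_zero : padicHaar p {(0 : ℚ_[p])} = 0 := by
  by_contra h
  have hpR := pR_pos (p := p)
  have h1 : ∀ n : ℕ, padicHaar p {(0 : ℚ_[p])} ≤ ENNReal.ofReal (((p : ℝ)⁻¹) ^ n) := by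
    intro n
    have := ball_measure (p := p) (-(n : ℤ))
    rw [zpow_neg, zpow_natCast, ← inv_pow] at this
    rw [← this]
    apply measure_mono
    simp
  have h2 : Filter.Tendsto (fun n : ℕ => ENNReal.ofReal (((p : ℝ)⁻¹) ^ n)) Filter.atTop
      (nhds 0) := by
    have := ENNReal.tendsto_ofReal (tendsto_pow_atTop_nhds_zero_of_lt_one
      (by positivity) (inv_lt_one_of_one_lt₀ (pR_one_lt (p := p))))
    simpa using this
  exact h (le_antisymm (ge_of_tendsto' h2 h1) bot_le)

lemma iUnion_spheres : (⋃ k : ℤ, sphere (0 : ℚ_[p]) ((p : ℝ) ^ k)) = {(0 : ℚ_[p])}ᶜ := by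
  ext x
  simp only [Set.mem_iUnion, mem_sphere, dist_zero_right, Set.mem_compl_iff,
    Set.mem_singleton_iff]
  constructor
  · rintro ⟨k, hk⟩ rfl
    rw [norm_zero] at hk
    exact (zpow_pos (pR_pos (p := p)) k).ne hk
  · intro hx
    exact ⟨_, Padic.norm_eq_zpow_neg_valuation hx⟩

lemma compl_zero_ae : ({(0 : ℚ_[p])}ᶜ : Set ℚ_[p]) =ᵐ[padicHaar p] Set.univ := by
  rw [ae_eq_univ, compl_compl]; exact haar_zero

/-- Integration of radial functions. -/
lemma radial_integral (g : ℚ_[p] → ℝ) (G : ℤ → ℝ)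
    (hg : ∀ (k : ℤ) (x : ℚ_[p]), ‖x‖ = (p : ℝ) ^ k → g x = G k) {s : ℝ}
    (hs : HasSum (fun k : ℤ => (p : ℝ) ^ k * G k) s) :
    Integrable g (padicHaar p) ∧ ∫ x, g x ∂(padicHaar p) = (1 - (p : ℝ)⁻¹) * s := by
  have hm : ∀ k : ℤ, MeasurableSet (sphere (0 : ℚ_[p]) ((p : ℝ) ^ k)) := fun k =>
    isClosed_sphere.measurableSet
  have hfin : ∀ k : ℤ, padicHaar p (sphere (0 : ℚ_[p]) ((p : ℝ) ^ k)) ≠ ⊤ := fun k =>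
    ((measure_mono sphere_subset_closedBall).trans_lt
      (by rw [ball_measure]; exact ENNReal.ofReal_lt_top)).ne
  have hi : ∀ k : ℤ, IntegrableOn g (sphere (0 : ℚ_[p]) ((p : ℝ) ^ k)) (padicHaar p) := by
    intro k
    have : IntegrableOn (fun _ => G k) (sphere (0 : ℚ_[p]) ((p : ℝ) ^ k)) (padicHaar p) :=
      integrableOn_const (hfin k)
    refine this.congr_fun ?_ (hm k)
    intro x hx
    exact (hg k x (by simpa using hx)).symm
  have hint : ∀ (φ : ℝ → ℝ) (k : ℤ),
      ∫ x in sphere (0 : ℚ_[p]) ((p : ℝ) ^ k), φ (g x) ∂(padicHaar p) =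
      (1 - (p : ℝ)⁻¹) * ((p : ℝ) ^ k * φ (G k)) := by
    intro φ k
    rw [setIntegral_congr_fun (g := fun _ => φ (G k)) (hm k), setIntegral_const, sphere_measure,
      smul_eq_mul, mul_assoc]
    intro x hx
    simp only [hg k x (by simpa using hx)]
  have hU : IntegrableOn g (⋃ k : ℤ, sphere (0 : ℚ_[p]) ((p : ℝ) ^ k)) (padicHaar p) := by
    apply integrableOn_iUnion_of_summable_integral_norm hi
    simp only [hint (fun y => ‖y‖)]
    apply Summable.mul_left
    refine hs.summable.norm.congr fun k => ?_
    rw [norm_mul, Real.norm_of_nonneg (zpow_pos (pR_pos (p := p)) k).le]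
  have hd : Pairwise (Function.onFun Disjoint
      (fun k : ℤ => sphere (0 : ℚ_[p]) ((p : ℝ) ^ k))) := by
    intro i j hij
    rw [Function.onFun, Set.disjoint_left]
    intro x hx hy
    simp only [mem_sphere, dist_zero_right] at hx hy
    exact hij (zpow_right_injective₀ (pR_pos (p := p)) (pR_one_lt (p := p)).ne'
      (hx.symm.trans hy))
  have hsum := hasSum_integral_iUnion hm hd hU
  simp only [hint (fun y => y)] at hsum
  rw [iUnion_spheres] at hsum hU
  rw [setIntegral_congr_set compl_zero_ae, setIntegral_univ] at hsum
  rw [integrableOn_congr_set_ae compl_zero_ae, integrableOn_univ] at hU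
  exact ⟨hU, hsum.unique (hs.mul_left _)⟩

end MeasurePart

section CorePart
set_option linter.unusedSectionVars false

/-- Geometric partial sums. -/
noncomputable def gS (ρ : ℝ) (m : ℕ) : ℝ := ∑ i ∈ Finset.range m, ρ ^ i

/-- The convolution kernel. -/
noncomputable def gK (a b : ℝ) (r : ℤ) : ℝ := -((1 - a) * (1 - b)) * gS (b / a) r.toNat + if r = 0 then a else 0

/-- Weights. -/
noncomputable def gA (a b : ℝ) (m : ℤ) : ℝ := if 0 ≤ m then a ^ m.toNat else b ^ (-m).toNat

lemma gS_zero (ρ : ℝ) : gS ρ 0 = 0 := by simp [gS]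
lemma gS_succ (ρ : ℝ) (m : ℕ) : gS ρ (m + 1) = gS ρ m + ρ ^ m := by simp [gS, Finset.sum_range_succ]
lemma gS_succ' (ρ : ℝ) (m : ℕ) : gS ρ (m + 1) = 1 + ρ * gS ρ m := by
  simp only [gS, Finset.sum_range_succ', Finset.mul_sum]
  simp only [pow_succ', pow_zero]; ring
lemma gS_add (ρ : ℝ) (q m : ℕ) : gS ρ (q + m) = gS ρ q + ρ ^ q * gS ρ m := by
  simp only [gS, Finset.sum_range_add, Finset.mul_sum, pow_add]
lemma gS_nonneg {ρ : ℝ} (h : 0 ≤ ρ) (m : ℕ) : 0 ≤ gS ρ m :=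
  Finset.sum_nonneg fun _ _ => by positivity

lemma gS_le {ρ R : ℝ} (h : 0 ≤ ρ) (hR : 1 < R) (hρ : ρ ≤ R) (m : ℕ) :
    gS ρ m ≤ (R - 1)⁻¹ * R ^ m := by
  have h1 : gS ρ m ≤ ∑ i ∈ Finset.range m, R ^ i :=
    Finset.sum_le_sum fun i _ => pow_le_pow_left₀ h hρ i
  rw [geom_sum_eq hR.ne'] at h1
  have : 0 < R - 1 := by linarith
  refine h1.trans ?_
  rw [div_eq_inv_mul]
  gcongr
  linarith

variable {a b : ℝ} (ha : 0 < a) (ha1 : a < 1) (hb : 0 < b) (hb1 : b < 1)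

include ha ha1 hb hb1

lemma hasSum_gS : HasSum (fun m : ℕ => a ^ m * gS (b / a) m) (a / ((1 - a) * (1 - b))) := by
  have h1 := hasSum_geometric_of_lt_one ha.le ha1
  have h2 := hasSum_geometric_of_lt_one hb.le hb1
  have h3 := hasSum_sum_range_mul_of_summable_norm h2.summable.norm h1.summable.norm
  rw [h1.tsum_eq, h2.tsum_eq] at h3
  have h4 : HasSum (fun m : ℕ => a ^ (m + 1) * gS (b / a) (m + 1)) (a / ((1 - a) * (1 - b))) := by
    convert! h3.mul_left a using 1
    · funext m
      rw [gS, Finset.mul_sum, Finset.mul_sum]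
      refine Finset.sum_congr rfl fun i hi => ?_
      have him : i ≤ m := by simp at hi; omega
      obtain ⟨d, rfl⟩ := Nat.exists_eq_add_of_le him
      rw [Nat.add_sub_cancel_left, div_pow]
      field_simp
      ring
    · have : 1 - a ≠ 0 := by linarith
      have : 1 - b ≠ 0 := by linarith
      field_simp
  rw [← hasSum_nat_add_iff' 1]
  simpa [gS_zero] using h4

lemma hasSum_gS_int : HasSum (fun m : ℤ => a ^ m * gS (b / a) m.toNat)
    (a / ((1 - a) * (1 - b))) := by
  have h := HasSum.of_nat_of_neg_add_one (f := fun m : ℤ => a ^ m * gS (b / a) m.toNat)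
    (m := a / ((1 - a) * (1 - b))) (m' := 0) (by simpa using hasSum_gS ha ha1 hb hb1) ?_
  · simpa using h
  · convert! hasSum_zero using 2 with n
    rw [show (-((n : ℤ) + 1)).toNat = 0 by omega, gS_zero, mul_zero]

lemma hasSum_gK : HasSum (fun m : ℕ => a ^ m * gK a b m) 0 := by
  have h1 := (hasSum_gS ha ha1 hb hb1).mul_left (-((1 - a) * (1 - b)))
  have h2 := hasSum_ite_eq (0 : ℕ) a
  convert! h1.add h2 using 1
  · funext m
    simp only [gK, Int.toNat_natCast]
    by_cases hm : m = 0
    · subst hm; simp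
    · simp [hm]; ring
  · have : 1 - a ≠ 0 := by linarith
    have : 1 - b ≠ 0 := by linarith
    field_simp
    ring

lemma gX (q : ℕ) : ∑ n ∈ Finset.range (q + 1), b ^ (n + 1) * gK a b ((q - n : ℕ) : ℤ) =
    a * (b / a) ^ (q + 1) - (1 - a) * b * gS (b / a) (q + 1) := by
  induction q with
  | zero =>
    simp [gK, gS]; field_simp; ring
  | succ q ih =>
    rw [Finset.sum_range_succ']
    have : ∀ n ∈ Finset.range (q + 1), b ^ (n + 1 + 1) * gK a b ((q + 1 - (n + 1) : ℕ) : ℤ) =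
        b * (b ^ (n + 1) * gK a b ((q - n : ℕ) : ℤ)) := by
      intro n hn
      rw [Nat.add_sub_add_right]; ring
    rw [Finset.sum_congr rfl this, ← Finset.mul_sum, ih]
    simp only [gK, Nat.sub_zero, Int.toNat_natCast]
    rw [if_neg (by omega), gS_succ _ (q + 1)]
    have : (b / a) ^ (q + 1 + 1) * a = b * (b / a) ^ (q + 1) := by
      rw [pow_succ (b / a) (q + 1)]; field_simp
    linear_combination (-1 : ℝ) * this

lemma hasSum_L (r : ℤ) : HasSum (fun m : ℤ => gA a b m * (gK a b (r + m) - gK a b r))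
    (if r = 0 then -(a * (1 - a * b)) / ((1 - a) * (1 - b)) else 0) := by
  have ha' : 1 - a ≠ 0 := by linarith
  have hb' : 1 - b ≠ 0 := by linarith
  have hAn : ∀ n : ℕ, gA a b (n : ℤ) = a ^ n := by intro n; simp [gA]
  have hAm : ∀ n : ℕ, gA a b (-((n : ℤ) + 1)) = b ^ (n + 1) := by
    intro n
    rw [gA, if_neg (by omega), show (- -((n : ℤ) + 1)).toNat = n + 1 by omega]
  have hneg : ∀ s : ℤ, s < 0 → gK a b s = 0 := by
    intro s hs
    rw [gK, if_neg (by omega), show s.toNat = 0 by omega, gS_zero]; ring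
  have hga := hasSum_geometric_of_lt_one ha.le ha1
  have hgb := (hasSum_geometric_of_lt_one hb.le hb1).mul_left b
  rcases lt_trichotomy r 0 with hr | hr | hr
  · rw [if_neg hr.ne]
    obtain ⟨q, rfl⟩ : ∃ q : ℕ, r = -((q : ℤ) + 1) := ⟨(-r - 1).toNat, by omega⟩
    rw [show (0 : ℝ) = 0 + 0 by ring]
    apply HasSum.of_nat_of_neg_add_one
    · rw [← hasSum_nat_add_iff' (q + 1)]
      have h := (hasSum_gK ha ha1 hb hb1).mul_left (a ^ (q + 1))
      convert! h using 1
      · funext n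
        rw [hAn, hneg (-((q : ℤ) + 1)) hr]
        rw [show -((q : ℤ) + 1) + ((n + (q + 1) : ℕ) : ℤ) = n by push_cast; ring]
        ring
      · rw [Finset.sum_eq_zero]
        · ring
        · intro i hi
          have : i < q + 1 := by simpa using hi
          rw [hneg (-((q : ℤ) + 1)) hr, hneg _ (by omega)]; ring
    · convert! hasSum_zero using 2 with n
      rw [hneg (-((q : ℤ) + 1)) hr, hneg _ (by omega)]; ring
  · subst hr
    rw [if_pos rfl]
    have hK0 : gK a b 0 = a := by simp [gK, gS_zero]
    have h1 := (hasSum_gK ha ha1 hb hb1).sub (hga.mul_left a)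
    have h2 := hgb.mul_left (-a)
    have h := HasSum.of_nat_of_neg_add_one
      (f := fun m : ℤ => gA a b m * (gK a b (0 + m) - gK a b 0))
      (m := 0 - a * (1 - a)⁻¹) (m' := -a * (b * (1 - b)⁻¹)) ?_ ?_
    · convert! h using 1
      field_simp; ring
    · convert! h1 using 2 with n
      rw [hAn, hK0, zero_add]; ring
    · convert! h2 using 2 with n
      rw [hAm, hK0, hneg _ (by omega)]; ring
  · rw [if_neg hr.ne']
    obtain ⟨q, rfl⟩ : ∃ q : ℕ, r = ((q + 1 : ℕ) : ℤ) := ⟨(r - 1).toNat, by omega⟩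
    have h1 := (hasSum_gS ha ha1 hb hb1).mul_left (-((1 - a) * (1 - b)) * (b / a) ^ (q + 1))
    have hfin : HasSum (fun n : ℕ => b ^ (n + 1) * gK a b ((q : ℤ) - n))
        (∑ n ∈ Finset.range (q + 1), b ^ (n + 1) * gK a b ((q : ℤ) - n)) := by
      apply hasSum_sum_of_ne_finset_zero
      intro n hn
      have : q + 1 ≤ n := by simpa using hn
      rw [hneg _ (by omega), mul_zero]
    have hfe : ∑ n ∈ Finset.range (q + 1), b ^ (n + 1) * gK a b ((q : ℤ) - n) =
        a * (b / a) ^ (q + 1) - (1 - a) * b * gS (b / a) (q + 1) := by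
      rw [← gX ha ha1 hb hb1 q]
      refine Finset.sum_congr rfl fun n hn => ?_
      have : n < q + 1 := by simpa using hn
      rw [Nat.cast_sub (by omega)]
    rw [hfe] at hfin
    have h2 := hfin.sub (hgb.mul_left (gK a b ((q + 1 : ℕ) : ℤ)))
    have hKq : gK a b ((q + 1 : ℕ) : ℤ) = -((1 - a) * (1 - b)) * gS (b / a) (q + 1) := by
      rw [gK, if_neg (by omega), Int.toNat_natCast, add_zero]
    have h := HasSum.of_nat_of_neg_add_one
      (f := fun m : ℤ => gA a b m * (gK a b (((q + 1 : ℕ) : ℤ) + m) - gK a b ((q + 1 : ℕ) : ℤ)))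
      (m := _) (m' := _) (by
        convert! h1 using 2 with n
        rw [hAn, hKq, ← Nat.cast_add, gK, if_neg (by omega), Int.toNat_natCast, gS_add]
        ring) (by
        convert! h2 using 2 with n
        rw [hAm, show ((q + 1 : ℕ) : ℤ) + -((n : ℤ) + 1) = (q : ℤ) - n by push_cast; ring]
        ring)
    convert! h using 1
    rw [hKq]
    field_simp
    ring

lemma gK_bound {R : ℝ} (hR : 1 < R) (hρ : b / a ≤ R) (r : ℤ) :
    |gK a b r| ≤ ((1 - a) * (1 - b) * (R - 1)⁻¹ + a) * R ^ r.toNat := by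
  have h1 := gS_le (by positivity) hR hρ r.toNat
  have h0 := gS_nonneg (ρ := b / a) (by positivity) r.toNat
  have hc : 0 < (1 - a) * (1 - b) := mul_pos (by linarith) (by linarith)
  have hRp : 1 ≤ R ^ r.toNat := one_le_pow₀ hR.le
  have h2 : |if r = 0 then a else 0| ≤ a := by split_ifs <;> simp [abs_of_pos, ha, ha.le]
  calc |gK a b r| ≤ |-((1 - a) * (1 - b)) * gS (b / a) r.toNat| + |if r = 0 then a else 0| :=
        abs_add_le _ _
    _ ≤ (1 - a) * (1 - b) * gS (b / a) r.toNat + a := by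
        rw [abs_mul, abs_neg, abs_of_pos hc, abs_of_nonneg h0]; linarith
    _ ≤ (1 - a) * (1 - b) * ((R - 1)⁻¹ * R ^ r.toNat) + a * R ^ r.toNat := by
        gcongr
        exact le_mul_of_one_le_right ha.le hRp
    _ = _ := by ring

lemma summable_gA {R : ℝ} (hR : 1 < R) (haR : a * R < 1) :
    Summable (fun m : ℤ => gA a b m * R ^ m.toNat) := by
  apply Summable.of_nat_of_neg_add_one
  · have := summable_geometric_of_lt_one (r := a * R) (by positivity) haR
    refine this.congr fun n => ?_
    simp [gA, mul_pow]
  · have := (summable_geometric_of_lt_one hb.le hb1).mul_left b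
    refine this.congr fun n => ?_
    rw [gA, if_neg (by omega), show (- -((n : ℤ) + 1)).toNat = n + 1 by omega,
      show (-((n : ℤ) + 1)).toNat = 0 by omega]
    ring

lemma gA_nonneg (m : ℤ) : 0 ≤ gA a b m := by
  unfold gA; split_ifs <;> positivity

lemma core_sum {R : ℝ} (hR : 1 < R) (hρ : b / a ≤ R) (haR : a * R < 1) (n : ℤ)
    (w U : ℤ → ℝ) (u0 : ℝ) (hU : ∀ k, HasSum (fun j => gK a b (k - j) * w j) (U k - u0))
    (hw : Summable (fun j : ℤ => R ^ (n - j).toNat * |w j|)) :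
    HasSum (fun m : ℤ => gA a b m * (U (n + m) - U n))
      (w n * (-(a * (1 - a * b)) / ((1 - a) * (1 - b)))) := by
  set C := (1 - a) * (1 - b) * (R - 1)⁻¹ + a with hC
  have hC0 : 0 ≤ C := by
    have h1 : 0 < (1 - a) := by linarith
    have h2 : 0 < (1 - b) := by linarith
    have h3 : 0 < R - 1 := by linarith
    positivity
  let F : ℤ × ℤ → ℝ := fun x => gA a b x.1 * (gK a b (n - x.2 + x.1) - gK a b (n - x.2)) * w x.2
  have hF : Summable F := by
    have hprod := (Summable.mul_of_nonneg (summable_gA ha ha1 hb hb1 hR haR) hw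
      (fun m => mul_nonneg (gA_nonneg ha ha1 hb hb1 m) (by positivity))
      (fun j => by positivity)).mul_left (2 * C)
    refine Summable.of_norm_bounded hprod ?_
    rintro ⟨m, j⟩
    simp only [F, Real.norm_eq_abs, abs_mul, abs_of_nonneg (gA_nonneg ha ha1 hb hb1 m)]
    have e1 : |gK a b (n - j + m)| ≤ C * (R ^ m.toNat * R ^ (n - j).toNat) := by
      refine (gK_bound ha ha1 hb hb1 hR hρ _).trans ?_
      rw [← pow_add]
      exact mul_le_mul_of_nonneg_left (pow_le_pow_right₀ hR.le (by omega)) hC0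
    have e2 : |gK a b (n - j)| ≤ C * (R ^ m.toNat * R ^ (n - j).toNat) := by
      refine (gK_bound ha ha1 hb hb1 hR hρ _).trans ?_
      rw [← pow_add]
      exact mul_le_mul_of_nonneg_left (pow_le_pow_right₀ hR.le (by omega)) hC0
    have e3 := (abs_sub (gK a b (n - j + m)) (gK a b (n - j))).trans (add_le_add e1 e2)
    calc gA a b m * |gK a b (n - j + m) - gK a b (n - j)| * |w j| ≤
        gA a b m * (C * (R ^ m.toNat * R ^ (n - j).toNat) + C * (R ^ m.toNat * R ^ (n - j).toNat))
          * |w j| := by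
            gcongr
            exact gA_nonneg ha ha1 hb hb1 m
      _ = _ := by ring
  obtain ⟨s, hs⟩ := hF
  have h1 : HasSum (fun m : ℤ => gA a b m * (U (n + m) - U n)) s := by
    refine hs.prod_fiberwise fun m => ?_
    have := ((hU (n + m)).sub (hU n)).mul_left (gA a b m)
    convert! this using 1
    · funext j
      simp only [F]
      rw [show n - j + m = n + m - j by ring]; ring
    · ring
  have h2 : HasSum (fun j : ℤ => (if n - j = 0 then -(a * (1 - a * b)) / ((1 - a) * (1 - b))
      else 0) * w j) s := by
    have hs' := (Equiv.prodComm ℤ ℤ).hasSum_iff.2 hs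
    refine hs'.prod_fiberwise fun j => ?_
    exact (hasSum_L ha ha1 hb hb1 (n - j)).mul_right (w j)
  have h3 : HasSum (fun j : ℤ => (if n - j = 0 then -(a * (1 - a * b)) / ((1 - a) * (1 - b))
      else 0) * w j) (w n * (-(a * (1 - a * b)) / ((1 - a) * (1 - b)))) := by
    convert! hasSum_ite_eq n (w n * (-(a * (1 - a * b)) / ((1 - a) * (1 - b)))) using 2 with j
    by_cases hj : j = n
    · subst hj; simp [mul_comm]
    · rw [if_neg (by omega), if_neg hj, zero_mul]
  rw [← h2.unique h3]
  exact h1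

end CorePart

section FormulaPart

variable {p : ℕ} [hp : Fact p.Prime]

lemma zpow_rpow_comm (k : ℤ) (s : ℝ) : ((p : ℝ) ^ k) ^ s = ((p : ℝ) ^ s) ^ k := by
  have h := (pR_pos (p := p)).le
  rw [← Real.rpow_intCast, ← Real.rpow_intCast, ← Real.rpow_mul h, ← Real.rpow_mul h, mul_comm]

lemma p_rpow_one {s : ℝ} (h : (p : ℝ) ^ s = 1) : s = 0 := by
  have h2 := congrArg Real.log h
  rw [Real.log_rpow (pR_pos (p := p)), Real.log_one] at h2
  exact (mul_eq_zero.1 h2).resolve_right (Real.log_pos (pR_one_lt (p := p))).ne'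

lemma summable_w {G θ R M A : ℝ} (n : ℤ) (w : ℤ → ℝ) (hR : 1 < R) (hRG : R < G)
    (hθ0 : 0 < θ) (hθ : θ < 1) (h1 : ∀ j : ℤ, |w j| ≤ M * G ^ j)
    (h2 : ∀ j : ℤ, 1 ≤ j → |w j| ≤ A * θ ^ j) :
    Summable (fun j : ℤ => R ^ (n - j).toNat * |w j|) := by
  have hG : 0 < G := by linarith
  have hM : 0 ≤ M := by have := (abs_nonneg _).trans (h1 0); simpa using this
  apply Summable.of_nat_of_neg_add_one
  · refine Summable.of_nonneg_of_le (fun j => by positivity) ?_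
      ((summable_geometric_of_lt_one hθ0.le hθ).mul_left (R ^ n.toNat * (|A| + M)))
    intro j
    rw [mul_assoc]
    apply mul_le_mul (pow_le_pow_right₀ hR.le (by omega)) _ (abs_nonneg _) (by positivity)
    rcases Nat.eq_zero_or_pos j with rfl | hj
    · have := h1 0
      simp only [zpow_zero, mul_one] at this
      simp only [Nat.cast_zero, pow_zero, mul_one]
      linarith [abs_nonneg A]
    · have := h2 j (by omega)
      rw [zpow_natCast] at this
      refine this.trans ?_
      gcongr
      linarith [le_abs_self A]
  · have hlt : R / G < 1 := by rw [div_lt_one hG]; exact hRG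
    refine Summable.of_nonneg_of_le (fun j => by positivity) ?_
      ((summable_geometric_of_lt_one (by positivity) hlt).mul_left (R ^ n.toNat * M * (R / G)))
    intro j
    calc R ^ (n - -((j : ℤ) + 1)).toNat * |w (-((j : ℤ) + 1))|
        ≤ R ^ (n.toNat + (j + 1)) * (M * G ^ (-((j : ℤ) + 1))) := by
          apply mul_le_mul (pow_le_pow_right₀ hR.le (by omega)) (h1 _) (abs_nonneg _) (by positivity)
      _ = _ := by
          rw [zpow_neg, pow_add, show ((j : ℤ) + 1) = ((j + 1 : ℕ) : ℤ) by push_cast; rfl,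
            zpow_natCast, mul_assoc (R ^ n.toNat * M), ← pow_succ', div_pow]
          field_simp

/-- Radial profile in the kernel of the fractional integral. -/
noncomputable def hk (p : ℕ) (α : ℝ) (k : ℤ) : ℝ :=
  if α = 1 then k * Real.log p else ((p : ℝ) ^ (α - 1)) ^ k

/-- The function in the kernel of the fractional integral. -/
noncomputable def hf (p : ℕ) [Fact p.Prime] (α : ℝ) (x : ℚ_[p]) : ℝ :=
  if α = 1 then Real.log ‖x‖ else ‖x‖ ^ (α - 1)

lemma Iker_eq (α : ℝ) (x y : ℚ_[p]) : Iker p α x y = hf p α (x - y) - hf p α y := by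
  unfold Iker hf; split_ifs <;> rfl

lemma hf_eq (α : ℝ) (x : ℚ_[p]) (k : ℤ) (hx : ‖x‖ = (p : ℝ) ^ k) : hf p α x = hk p α k := by
  unfold hf hk
  rw [hx, Real.log_zpow, zpow_rpow_comm]

lemma hf_congr (α : ℝ) {x y : ℚ_[p]} (h : ‖x‖ = ‖y‖) : hf p α x = hf p α y := by
  unfold hf; rw [h]

variable {α a b : ℝ} (hα : 0 < α) (ha : a = (p : ℝ) ^ (-α)) (hb : b = (p : ℝ)⁻¹)

include hα ha hb

lemma ab_facts : 0 < a ∧ a < 1 ∧ 0 < b ∧ b < 1 ∧ b / a = (p : ℝ) ^ (α - 1) := by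
  have h0 := pR_pos (p := p)
  have h1 := pR_one_lt (p := p)
  subst ha hb
  refine ⟨by positivity, Real.rpow_lt_one_of_one_lt_of_neg h1 (by linarith), by positivity,
    inv_lt_one_of_one_lt₀ h1, ?_⟩
  rw [Real.rpow_sub h0, Real.rpow_neg h0.le, Real.rpow_one]
  field_simp

lemma Icoef_ne : Icoef p α ≠ 0 := by
  have h0 := pR_pos (p := p)
  have h1 := pR_one_lt (p := p)
  obtain ⟨ha0, ha1, -, -, -⟩ := ab_facts hα ha hb
  have hl := Real.log_pos h1
  unfold Icoef
  split_ifs with h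
  · exact div_ne_zero (by linarith) (by positivity)
  · rw [← ha]
    refine div_ne_zero (by linarith) ?_
    intro hh
    have : (p : ℝ) ^ (α - 1) = 1 := by linarith
    replace this := p_rpow_one this
    exact h (by linarith)

lemma Icoef_hk (n k : ℤ) (hkn : k ≤ n) : Icoef p α * ((p : ℝ) ^ k * (hk p α n - hk p α k)) =
    -(1 - a) * (a ^ (-k) * gS (b / a) (n - k).toNat) := by
  have h0 := pR_pos (p := p)
  have h1 := pR_one_lt (p := p)
  obtain ⟨ha0, ha1, hb0, hb1, hρ⟩ := ab_facts hα ha hb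
  obtain ⟨m, rfl⟩ : ∃ m : ℕ, n = k + m := ⟨(n - k).toNat, by omega⟩
  rw [show (k + (m : ℤ) - k).toNat = m by omega]
  have hl := Real.log_pos h1
  have hpb : (p : ℝ) = b⁻¹ := by rw [hb, inv_inv]
  unfold Icoef hk
  split_ifs with h
  · have hab : a = b := by rw [ha, hb, h, Real.rpow_neg_one]
    have hS : gS (b / a) m = m := by rw [hab, div_self hb0.ne']; simp [gS]
    rw [hS, hab, zpow_neg, ← inv_zpow, ← hpb, hb]
    push_cast
    field_simp
    ring
  · have hρ1 : b / a ≠ 1 := by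
      rw [hρ]
      intro hh
      replace hh := p_rpow_one hh
      exact h (by linarith)
    rw [← ha, ← hρ, gS, geom_sum_eq hρ1, zpow_add₀ (by positivity), zpow_natCast, hpb, inv_zpow,
      zpow_neg, div_zpow]
    have h2 : 1 - b / a ≠ 0 := fun hh => hρ1 (by linarith)
    have h3 : b / a - 1 ≠ 0 := fun hh => hρ1 (by linarith)
    have h4 : b / a - 1 = -(1 - b / a) := by ring
    rw [h4]
    have hak : a ^ k ≠ 0 := by positivity
    have hbk : b ^ k ≠ 0 := by positivity
    generalize (b / a) ^ m = X
    generalize hY : 1 - b / a = Y at *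
    field_simp

lemma Iop_formula (φ : ℚ_[p] → ℝ) (v : ℤ → ℝ) (n : ℤ) (t : ℚ_[p])
    (hφ : ∀ (k : ℤ) (x : ℚ_[p]), ‖x‖ = (p : ℝ) ^ k → φ x = v k) (ht : ‖t‖ = (p : ℝ) ^ n)
    (hsum : Summable (fun j : ℤ => gS (b / a) (n - j).toNat * (a ^ (-j) * v j))) :
    HasSum (fun j => gK a b (n - j) * (a ^ (-j) * v j)) (Iop p α φ t) := by
  have h0 := pR_pos (p := p)
  have h1 := pR_one_lt (p := p)
  obtain ⟨ha0, ha1, hb0, hb1, hρ⟩ := ab_facts hα ha hb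
  have hI := Icoef_ne hα ha hb
  set c := Icoef p α with hc
  obtain ⟨σ, hσ⟩ := hsum
  have hle : ∀ (k : ℤ) (x : ℚ_[p]), ‖x‖ = (p : ℝ) ^ k → (‖x‖ ≤ ‖t‖ ↔ k ≤ n) := by
    intro k x hx
    rw [hx, ht, zpow_le_zpow_iff_right₀ h1]
  -- first radial part
  let G1 : ℚ_[p] → ℝ := fun y => if ‖y‖ ≤ ‖t‖ then (hf p α t - hf p α y) * φ y else 0
  have s1 : HasSum (fun k : ℤ => (p : ℝ) ^ k *
      (if k ≤ n then (hk p α n - hk p α k) * v k else 0)) (c⁻¹ * (-(1 - a) * σ)) := by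
    convert! (hσ.mul_left (-(1 - a))).mul_left c⁻¹ using 2 with k
    split_ifs with h
    · have := Icoef_hk hα ha hb n k h
      rw [← hc] at this
      rw [eq_inv_mul_iff_mul_eq₀ hI]
      linear_combination v k * this
    · rw [show (n - k).toNat = 0 by omega, gS_zero]; ring
  have r1 := radial_integral G1 _ (by
    intro k x hx
    simp only [G1, hle k x hx, hf_eq α t n ht, hf_eq α x k hx, hφ k x hx]) s1
  let G2 : ℚ_[p] → ℝ := fun y => if ‖y‖ ≤ ‖t‖ then (hf p α y - hf p α t) else 0
  have s2 : HasSum (fun k : ℤ => (p : ℝ) ^ k *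
      (if k ≤ n then (hk p α k - hk p α n) else 0))
      (c⁻¹ * ((1 - a) * (a ^ (-n) * (a / ((1 - a) * (1 - b)))))) := by
    have := (Equiv.subLeft n).hasSum_iff.2 (hasSum_gS_int ha0 ha1 hb0 hb1)
    convert! ((this.mul_left (a ^ (-n))).mul_left (1 - a)).mul_left c⁻¹ using 2 with k
    simp only [Function.comp, Equiv.subLeft_apply]
    rw [← mul_assoc (a ^ (-n)), ← zpow_add₀ ha0.ne', show -n + (n - k) = -k by ring]
    split_ifs with h
    · have := Icoef_hk hα ha hb n k h
      rw [← hc] at this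
      rw [eq_inv_mul_iff_mul_eq₀ hI]
      linear_combination -this
    · rw [show (n - k).toNat = 0 by omega, gS_zero]; ring
  have r2 := radial_integral G2 _ (by
    intro k x hx
    simp only [G2, hle k x hx, hf_eq α t n ht, hf_eq α x k hx]) s2
  have hpt : ∀ y : ℚ_[p], Set.indicator {y : ℚ_[p] | ‖y‖ ≤ ‖t‖} (fun y => Iker p α t y * φ y) y =
      G1 y + v n * G2 (t - y) := by
    intro y
    have hiff : ‖t - y‖ ≤ ‖t‖ ↔ ‖y‖ ≤ ‖t‖ := by
      constructor
      · intro h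
        have := Padic.nonarchimedean t (-(t - y))
        rw [show t + -(t - y) = y by ring, norm_neg] at this
        exact this.trans (max_le le_rfl h)
      · intro h
        have := Padic.nonarchimedean t (-y)
        rw [← sub_eq_add_neg, norm_neg] at this
        exact this.trans (max_le le_rfl h)
    by_cases h : ‖y‖ ≤ ‖t‖
    · rw [Set.indicator_of_mem (by exact h)]
      simp only [G1, G2, hiff, if_pos h, Iker_eq]
      rcases h.lt_or_eq with h' | h'
      · have : ‖t - y‖ = ‖t‖ := by
          rw [sub_eq_add_neg, Padic.add_eq_max_of_ne (by rw [norm_neg]; exact h'.ne'), norm_neg,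
            max_eq_left h]
        rw [hf_congr α this]; ring
      · rw [hφ n y (h'.trans ht)]; ring
    · rw [Set.indicator_of_notMem (by exact h)]
      simp only [G1, G2, hiff, if_neg h]; ring
  have hms : MeasurableSet {y : ℚ_[p] | ‖y‖ ≤ ‖t‖} :=
    (isClosed_le continuous_norm continuous_const).measurableSet
  have hval : Iop p α φ t = -((1 - a) * (1 - b)) * σ + a * (a ^ (-n) * v n) := by
    have e1 : Integrable (fun y => v n * G2 (t - y)) (padicHaar p) :=
      (r2.1.comp_sub_left t).const_mul _
    unfold Iop
    rw [← integral_indicator hms]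
    simp only [hpt]
    rw [integral_add r1.1 e1, integral_const_mul, integral_sub_left_eq_self G2, r1.2, r2.2, ← hc, ← hb]
    have : 1 - a ≠ 0 := by linarith
    have : 1 - b ≠ 0 := by linarith
    field_simp
  rw [hval]
  have hfin := hasSum_ite_eq n (a * (a ^ (-n) * v n))
  convert! (hσ.mul_left (-((1 - a) * (1 - b)))).add hfin using 2 with j
  rw [gK]
  by_cases hj : j = n
  · subst hj; simp; ring
  · rw [if_neg (by omega), if_neg hj]; ring

lemma D_formula (u : ℚ_[p] → ℝ) (U : ℤ → ℝ) (n : ℤ) (t : ℚ_[p])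
    (hu : ∀ (k : ℤ) (x : ℚ_[p]), ‖x‖ = (p : ℝ) ^ k → u x = U k) (ht : ‖t‖ = (p : ℝ) ^ n) {s : ℝ}
    (hs : HasSum (fun m : ℤ => gA a b m * (U (n + m) - U n)) s) :
    Integrable (Dker p α u t) (padicHaar p) ∧
      ∫ y, Dker p α u t y ∂(padicHaar p) = (1 - b) * (a ^ n * s) := by
  have h0 := pR_pos (p := p)
  have h1 := pR_one_lt (p := p)
  obtain ⟨ha0, ha1, hb0, hb1, hρ⟩ := ab_facts hα ha hb
  have hle : ∀ (k : ℤ) (x : ℚ_[p]), ‖x‖ = (p : ℝ) ^ k → (‖x‖ ≤ ‖t‖ ↔ k ≤ n) := by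
    intro k x hx
    rw [hx, ht, zpow_le_zpow_iff_right₀ h1]
  have hab : (p : ℝ) ^ (-α - 1) = a * b := by
    rw [ha, hb, Real.rpow_sub h0, Real.rpow_one]; rfl
  have hpb : (p : ℝ) = b⁻¹ := by rw [hb, inv_inv]
  have hs' : HasSum (fun k : ℤ => a ^ n * (gA a b (k - n) * (U k - U n))) (a ^ n * s) := by
    have := ((Equiv.subRight n).hasSum_iff.2 hs).mul_left (a ^ n)
    convert! this using 2 with k
    simp [Function.comp]
  let G1 : ℚ_[p] → ℝ := fun z => if ‖z‖ ≤ ‖t‖ then ‖t‖ ^ (-α - 1) * (u z - u t) else 0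
  let G2 : ℚ_[p] → ℝ := fun z => if ‖z‖ ≤ ‖t‖ then 0 else ‖z‖ ^ (-α - 1) * (u z - u t)
  have e1 : ∀ k : ℤ, (p : ℝ) ^ k * (if k ≤ n then (a * b) ^ n * (U k - U n) else 0) =
      Set.indicator {k : ℤ | k ≤ n} (fun k : ℤ => a ^ n * (gA a b (k - n) * (U k - U n))) k := by
    intro k
    by_cases h : k ≤ n
    · rw [if_pos h, Set.indicator_of_mem (by exact h)]
      have : gA a b (k - n) = b ^ (n - k) := by
        rcases h.lt_or_eq with h' | h'
        · rw [gA, if_neg (by omega), ← zpow_natCast]; congr 1; omega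
        · subst h'; simp [gA]
      rw [this, hpb, mul_zpow, zpow_sub₀ hb0.ne', inv_zpow]
      field_simp
    · rw [if_neg h, Set.indicator_of_notMem (by exact h), mul_zero]
  have e2 : ∀ k : ℤ, (p : ℝ) ^ k * (if k ≤ n then 0 else (a * b) ^ k * (U k - U n)) =
      Set.indicator {k : ℤ | k ≤ n}ᶜ (fun k : ℤ => a ^ n * (gA a b (k - n) * (U k - U n))) k := by
    intro k
    by_cases h : k ≤ n
    · rw [if_pos h, Set.indicator_of_notMem (by simpa using h), mul_zero]
    · rw [if_neg h, Set.indicator_of_mem (by simpa using h)]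
      have : gA a b (k - n) = a ^ (k - n) := by
        rw [gA, if_pos (by omega), ← zpow_natCast]; congr 1; omega
      rw [this, hpb, mul_zpow, zpow_sub₀ ha0.ne', inv_zpow]
      field_simp
  obtain ⟨σ1, hσ1⟩ := hs'.summable.indicator {k : ℤ | k ≤ n}
  obtain ⟨σ2, hσ2⟩ := hs'.summable.indicator {k : ℤ | k ≤ n}ᶜ
  have hσ : σ1 + σ2 = a ^ n * s := by
    refine (hσ1.add hσ2).unique ?_
    convert! hs' using 2 with k
    exact Set.indicator_self_add_compl_apply _ _ _
  rw [funext fun k => (e1 k).symm] at hσ1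
  rw [funext fun k => (e2 k).symm] at hσ2
  have hut := hu n t ht
  have r1 := radial_integral G1 _ (by
    intro k x hx
    simp only [G1, hle k x hx, hut, hu k x hx]
    rw [ht, zpow_rpow_comm, hab]) hσ1
  have r2 := radial_integral G2 _ (by
    intro k x hx
    simp only [G2, hle k x hx, hut, hu k x hx]
    rw [hx, zpow_rpow_comm, hab]) hσ2
  have hpt : Dker p α u t = fun y => G1 (t - y) + G2 y := by
    funext y
    have hn : ∀ x z : ℚ_[p], ‖x‖ = ‖z‖ → z ≠ 0 → u x = u z := by
      intro x z hxz hz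
      have hz' := Padic.norm_eq_zpow_neg_valuation hz
      rw [hu _ z hz', hu _ x (hxz.trans hz')]
    have ht0 : t ≠ 0 := by
      rintro rfl
      rw [norm_zero] at ht
      exact (zpow_pos h0 n).ne ht
    have hiff : ‖t - y‖ ≤ ‖t‖ ↔ ‖y‖ ≤ ‖t‖ := by
      constructor
      · intro h
        have := Padic.nonarchimedean t (-(t - y))
        rw [show t + -(t - y) = y by ring, norm_neg] at this
        exact this.trans (max_le le_rfl h)
      · intro h
        have := Padic.nonarchimedean t (-y)
        rw [← sub_eq_add_neg, norm_neg] at this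
        exact this.trans (max_le le_rfl h)
    simp only [Dker, G1, G2, hiff]
    by_cases h : ‖y‖ ≤ ‖t‖
    · rw [if_pos h, if_pos h, add_zero]
      rcases h.lt_or_eq with h' | h'
      · have : ‖t - y‖ = ‖t‖ := by
          rw [sub_eq_add_neg, Padic.add_eq_max_of_ne (by rw [norm_neg]; exact h'.ne'), norm_neg,
            max_eq_left h]
        rw [hn _ _ this ht0]; ring
      · rw [h']
    · rw [if_neg h, if_neg h, zero_add]
      push Not at h
      have : ‖t - y‖ = ‖y‖ := by
        rw [sub_eq_add_neg, Padic.add_eq_max_of_ne (by rw [norm_neg]; exact h.ne), norm_neg,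
          max_eq_right h.le]
      have hy0 : y ≠ 0 := by
        rintro rfl
        rw [norm_zero] at h
        exact absurd h (not_lt.2 (norm_nonneg t))
      rw [hn _ _ this hy0]
  rw [hpt]
  have i1 := r1.1.comp_sub_left t
  refine ⟨i1.add r2.1, ?_⟩
  rw [integral_add i1 r2.1, integral_sub_left_eq_self G1, r1.2, r2.2, ← hσ, ← hb]
  ring

end FormulaPart

/-- a mild solution solves the degenerate pseudo-differential equation. -/
theorem mild_solution_solves_equation (p : ℕ) [Fact p.Prime] (α γ : ℝ)
    (hα : 0 < α) (hγ0 : 0 < γ) (hγ : γ < min 1 α) (u₀ M A β : ℝ) (f : ℤ → ℝ → ℝ)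
    (hβ : α < β + γ)
    (hM : ∀ (ℓ : ℤ) (x : ℝ), |f ℓ x| ≤ M)
    (Fl : ℤ → ℝ) (hFl0 : ∀ ℓ : ℤ, 0 < Fl ℓ) (hFl1 : ∀ ℓ : ℤ, Fl ℓ < (p : ℝ) ^ (-α * (ℓ : ℝ)))
    (hFlip : ∀ (ℓ : ℤ) (x y : ℝ), |f ℓ x - f ℓ y| ≤ Fl ℓ * |x - y|)
    (hA : ∀ ℓ : ℤ, 1 ≤ ℓ → ∀ x : ℝ, |f ℓ x| ≤ A * (p : ℝ) ^ (-β * (ℓ : ℝ)))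
    (u : ℚ_[p] → ℝ) (hu : Radial p u) (hu0 : u 0 = u₀)
    (N : ℤ) (B : ℝ) (hB : ∀ t : ℚ_[p], ‖t‖ ≤ (p : ℝ) ^ N → |u t| ≤ B)
    (heq : ∀ t : ℚ_[p], t ≠ 0 →
      IntegrableOn (fun y => Iker p α t y * (‖y‖ ^ (-γ) * f (-y.valuation) (u y)))
        {y : ℚ_[p] | ‖y‖ ≤ ‖t‖} (padicHaar p) ∧
      u t = u₀ + Iop p α (fun y => ‖y‖ ^ (-γ) * f (-y.valuation) (u y)) t) :
    ∀ t : ℚ_[p], t ≠ 0 →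
      Integrable (Dker p α u t) (padicHaar p) ∧
      (∀ t' : ℚ_[p], ‖t'‖ = ‖t‖ → Dop p α u t' = Dop p α u t) ∧
      ‖t‖ ^ γ * Dop p α u t = f (-t.valuation) (u t) := by
  have h0 := pR_pos (p := p)
  have h1 := pR_one_lt (p := p)
  have hγ1 : γ < 1 := hγ.trans_le (min_le_left _ _)
  have hγα : γ < α := hγ.trans_le (min_le_right _ _)
  obtain ⟨a, ha⟩ : ∃ a : ℝ, a = (p : ℝ) ^ (-α) := ⟨_, rfl⟩
  obtain ⟨b, hb⟩ : ∃ b : ℝ, b = (p : ℝ)⁻¹ := ⟨_, rfl⟩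
  obtain ⟨g, hg⟩ : ∃ g : ℝ, g = (p : ℝ) ^ (-γ) := ⟨_, rfl⟩
  obtain ⟨ha0, ha1, hb0, hb1, hρ⟩ := ab_facts hα ha hb
  have hg0 : 0 < g := by rw [hg]; positivity
  have hg1 : g < 1 := by rw [hg]; exact Real.rpow_lt_one_of_one_lt_of_neg h1 (by linarith)
  have hag : a < g := by rw [ha, hg]; exact Real.rpow_lt_rpow_of_exponent_lt h1 (by linarith)
  have hbg : b < g := by
    rw [hb, hg, ← Real.rpow_neg_one]; exact Real.rpow_lt_rpow_of_exponent_lt h1 (by linarith)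
  obtain ⟨R, hR1, hR2⟩ : ∃ R, max 1 (b / a) < R ∧ R < g / a := by
    apply exists_between
    rw [max_lt_iff, lt_div_iff₀ ha0, one_mul]
    exact ⟨hag, by gcongr⟩
  have hR : 1 < R := (le_max_left _ _).trans_lt hR1
  have hρR : b / a ≤ R := ((le_max_right _ _).trans_lt hR1).le
  have haR : a * R < 1 := by
    rw [lt_div_iff₀ ha0] at hR2
    nlinarith
  -- radial profiles
  let U : ℤ → ℝ := fun k => u (sph p k)
  have hsph : ∀ k : ℤ, ‖sph p k‖ = (p : ℝ) ^ k := by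
    intro k
    rw [sph, Padic.norm_p_zpow, neg_neg]
  have hsph0 : ∀ k : ℤ, sph p k ≠ 0 := by
    intro k hk
    have := hsph k
    rw [hk, norm_zero] at this
    exact (zpow_pos h0 k).ne this
  have hUu : ∀ (k : ℤ) (x : ℚ_[p]), ‖x‖ = (p : ℝ) ^ k → u x = U k := by
    intro k x hx
    exact hu _ _ (hx.trans (hsph k).symm)
  have hval : ∀ (k : ℤ) (x : ℚ_[p]), ‖x‖ = (p : ℝ) ^ k → -x.valuation = k := by
    intro k x hx
    have hx0 : x ≠ 0 := by
      rintro rfl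
      rw [norm_zero] at hx
      exact (zpow_pos h0 k).ne hx
    rw [Padic.norm_eq_zpow_neg_valuation hx0] at hx
    exact zpow_right_injective₀ h0 h1.ne' hx
  let v : ℤ → ℝ := fun k => g ^ k * f k (U k)
  have hφ : ∀ (k : ℤ) (x : ℚ_[p]), ‖x‖ = (p : ℝ) ^ k →
      ‖x‖ ^ (-γ) * f (-x.valuation) (u x) = v k := by
    intro k x hx
    simp only [v]
    rw [hval k x hx, hUu k x hx, hx, zpow_rpow_comm, ← hg]
  let w : ℤ → ℝ := fun j => a ^ (-j) * v j
  have hwabs : ∀ j, |w j| = (g / a) ^ j * |f j (U j)| := by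
    intro j
    simp only [w, v]
    rw [abs_mul, abs_mul, abs_of_pos (zpow_pos ha0 _), abs_of_pos (zpow_pos hg0 _), zpow_neg,
      div_zpow]
    field_simp
  have hw1 : ∀ j : ℤ, |w j| ≤ M * (g / a) ^ j := by
    intro j
    rw [hwabs, mul_comm]
    have := hM j (U j)
    gcongr
  have hw2 : ∀ j : ℤ, 1 ≤ j → |w j| ≤ A * (g / a * (p : ℝ) ^ (-β)) ^ j := by
    intro j hj
    rw [hwabs, mul_zpow]
    have := hA j hj (U j)
    rw [Real.rpow_mul h0.le, Real.rpow_intCast] at this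
    calc (g / a) ^ j * |f j (U j)| ≤ (g / a) ^ j * (A * ((p : ℝ) ^ (-β)) ^ j) := by gcongr
      _ = _ := by ring
  have hθ : g / a * (p : ℝ) ^ (-β) < 1 := by
    rw [hg, ha, ← Real.rpow_sub h0, ← Real.rpow_add h0]
    exact Real.rpow_lt_one_of_one_lt_of_neg h1 (by linarith)
  have hsw : ∀ n : ℤ, Summable (fun j : ℤ => R ^ (n - j).toNat * |w j|) := fun n =>
    summable_w n w hR hR2 (by positivity) hθ hw1 hw2
  have hSw : ∀ n : ℤ, Summable (fun j : ℤ => gS (b / a) (n - j).toNat * w j) := by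
    intro n
    refine Summable.of_norm_bounded ((hsw n).mul_left (R - 1)⁻¹) fun j => ?_
    have hnn := gS_nonneg (ρ := b / a) (by positivity) (n - j).toNat
    rw [norm_mul, Real.norm_of_nonneg hnn, Real.norm_eq_abs, ← mul_assoc]
    exact mul_le_mul_of_nonneg_right (gS_le (by positivity) hR hρR _) (abs_nonneg _)
  have hU : ∀ k, HasSum (fun j => gK a b (k - j) * w j) (U k - u₀) := by
    intro k
    have h := Iop_formula hα ha hb _ v k (sph p k) hφ (hsph k) (hSw k)
    have h2 := (heq (sph p k) (hsph0 k)).2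
    have h3 : U k - u₀ = Iop p α (fun y => ‖y‖ ^ (-γ) * f (-y.valuation) (u y)) (sph p k) := by
      simp only [U]; linarith
    rw [h3]; exact h
  have key : ∀ t : ℚ_[p], t ≠ 0 → Integrable (Dker p α u t) (padicHaar p) ∧
      ‖t‖ ^ γ * Dop p α u t = f (-t.valuation) (u t) := by
    intro t ht
    obtain ⟨n, hn⟩ : ∃ n : ℤ, ‖t‖ = (p : ℝ) ^ n := ⟨_, Padic.norm_eq_zpow_neg_valuation ht⟩
    have hcore := core_sum ha0 ha1 hb0 hb1 hR hρR haR n w U u₀ hU (hsw n)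
    obtain ⟨hi, hD⟩ := D_formula hα ha hb u U n t hUu hn hcore
    refine ⟨hi, ?_⟩
    have hab : (p : ℝ) ^ (-α - 1) = a * b := by
      rw [ha, hb, Real.rpow_sub h0, Real.rpow_one]; rfl
    have hpa : (p : ℝ) ^ α = a⁻¹ := by rw [ha, Real.rpow_neg h0.le, inv_inv]
    have hpg : (p : ℝ) ^ γ = g⁻¹ := by rw [hg, Real.rpow_neg h0.le, inv_inv]
    rw [Dop, hD, hval n t hn, hUu n t hn, hn, zpow_rpow_comm, hab, hpa, hpg]
    simp only [w, v]
    have e1 : 1 - a ≠ 0 := by linarith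
    have e2 : 1 - b ≠ 0 := by linarith
    have e3 : 1 - a * b ≠ 0 := by nlinarith
    rw [zpow_neg, inv_zpow]
    have e4 : a ^ n ≠ 0 := by positivity
    have e5 : g ^ n ≠ 0 := by positivity
    field_simp
    ring
  intro t ht
  obtain ⟨hi, hd⟩ := key t ht
  refine ⟨hi, ?_, hd⟩
  intro t' htt
  have ht' : t' ≠ 0 := by
    rintro rfl
    rw [norm_zero] at htt
    exact ht (norm_eq_zero.1 htt.symm)
  have hd' := (key t' ht').2
  have hv : -t'.valuation = -t.valuation :=
    hval _ _ (htt.trans (Padic.norm_eq_zpow_neg_valuation ht))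
  rw [hv, hu _ _ htt, htt, ← hd] at hd'
  have hpos : 0 < ‖t‖ ^ γ := Real.rpow_pos_of_pos (norm_pos_iff.2 ht) _
  exact mul_left_cancel₀ hpos.ne' hd'
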